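/- arXiv:1306.1787 — 2 statements merged into one kernel-verified Lean document; each statement's English description precedes it below -/
import Mathlib

section
/- Let m, n ∈ ℙ, a ∈ ℕ^n, b ∈ ℕ^m, and let Δ be a simplicial complex. If a is a permuted refinement of b (a ≤_pr b), then Δ being a-Macaulay decomposable implies Δ is b-Macaulay decomposable. -/
open Finset

/-- The vertex set of a finite simplicial complex, given as its finite set of faces. -/
def vertexSet {α : Type*} [DecidableEq α] (Δ : Finset (Finset α)) : Finset α := Δ.sup id

/-- `Δ` is a (finite) simplicial complex: a nonempty collection of finite subsets
closed under taking subsets.  (Every member of some face then automatically spans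
a face, so the vertex condition is automatic.) -/
def IsSimplicialComplex {α : Type*} (Δ : Finset (Finset α)) : Prop :=
  Δ.Nonempty ∧ ∀ F ∈ Δ, ∀ G ⊆ F, G ∈ Δ

/-- The deletion `dl_Δ(x)` of the vertex `x` from `Δ`. -/
def del {α : Type*} [DecidableEq α] (Δ : Finset (Finset α)) (x : α) : Finset (Finset α) :=
  Δ.filter fun τ => x ∉ τ

/-- The link `lk_Δ(x)` of the vertex `x` in `Δ`. -/
def lk {α : Type*} [DecidableEq α] (Δ : Finset (Finset α)) (x : α) : Finset (Finset α) :=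
  Δ.filter fun τ => x ∉ τ ∧ insert x τ ∈ Δ

/-- `F` is a facet (maximal face) of `Δ`. -/
def IsFacet {α : Type*} (Δ : Finset (Finset α)) (F : Finset α) : Prop :=
  F ∈ Δ ∧ ∀ G ∈ Δ, F ⊆ G → G = F

/-- The simplicial complex `⟨ℱ⟩` generated by a collection `ℱ` of faces. -/
def generatedComplex {α : Type*} [DecidableEq α] (S : Finset (Finset α)) :
    Finset (Finset α) :=
  insert ∅ (S.biUnion Finset.powerset)

/-- `(V 0, …, V (n-1))` is an ordered partition of `W` into nonempty parts. -/
def IsOrderedPartition {α : Type*} [DecidableEq α] {n : ℕ} (V : Fin n → Finset α)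
    (W : Finset α) : Prop :=
  (∀ i, (V i).Nonempty) ∧ (∀ i j, i ≠ j → Disjoint (V i) (V j)) ∧
    Finset.univ.biUnion V = W

/-- `Γ` is an `a`-rib of `Δ`: there is an ordered partition `V` of the vertex set
of `Δ` such that `Γ` is generated by the faces `F` of `Δ` with `|F ∩ V i| = a i`
for every `i`. -/
def IsRib {α : Type*} [DecidableEq α] {n : ℕ} (a : Fin n → ℕ) (Δ Γ : Finset (Finset α)) :
    Prop :=
  ∃ V : Fin n → Finset α, IsOrderedPartition V (vertexSet Δ) ∧
    (Δ.filter fun F => ∀ i, (F ∩ V i).card = a i).Nonempty ∧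
    Γ = generatedComplex (Δ.filter fun F => ∀ i, (F ∩ V i).card = a i)

/-- `Γ` is an `a`-rib of a simplex. -/
def IsRibOfSimplex {α : Type*} [DecidableEq α] {n : ℕ} (a : Fin n → ℕ)
    (Γ : Finset (Finset α)) : Prop :=
  ∃ F : Finset α, F.Nonempty ∧ IsRib a F.powerset Γ

/-- Vertex decomposability, in the non-pure sense of Björner and Wachs. -/
inductive VertexDecomposable {α : Type*} [DecidableEq α] : Finset (Finset α) → Prop
  | simplex (F : Finset α) (hF : F.Nonempty) : VertexDecomposable F.powerset
  | ofEmpty : VertexDecomposable {∅}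
  | shed (Δ : Finset (Finset α)) (x : α) (hC : IsSimplicialComplex Δ) (hx : {x} ∈ Δ)
      (hdl : VertexDecomposable (del Δ x)) (hlk : VertexDecomposable (lk Δ x))
      (hfac : ∀ F, IsFacet (lk Δ x) F → ¬ IsFacet (del Δ x) F) :
      VertexDecomposable Δ

/-- `a`-Macaulay decomposability. -/
inductive MacaulayDecomposable {α : Type*} [DecidableEq α] {n : ℕ} :
    (Fin n → ℕ) → Finset (Finset α) → Prop
  | rib (a : Fin n → ℕ) (Γ : Finset (Finset α)) (h : IsRibOfSimplex a Γ) :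
      MacaulayDecomposable a Γ
  | shed (a a' : Fin n → ℕ) (Δ : Finset (Finset α)) (x : α)
      (hC : IsSimplicialComplex Δ) (hx : {x} ∈ Δ) (hlt : a' < a)
      (hdl : MacaulayDecomposable a (del Δ x))
      (hlk : MacaulayDecomposable a' (lk Δ x))
      (hfac : ∀ F, IsFacet (lk Δ x) F → ¬ IsFacet (del Δ x) F) :
      MacaulayDecomposable a Δ

/-- `a` is an ordered refinement of `b`: consecutive blocks of entries of `a`
sum to the entries of `b`. -/
def OrderedRefinement {n m : ℕ} (a : Fin n → ℕ) (b : Fin m → ℕ) : Prop :=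
  ∃ g : Fin n → Fin m, Monotone g ∧ Function.Surjective g ∧
    ∀ t, b t = ∑ j ∈ Finset.univ.filter (fun j => g j = t), a j

/-- `a ≤_pr b`: some permutation of the entries of `a` is an ordered
refinement of `b`. -/
def PermutedRefinement {n m : ℕ} (a : Fin n → ℕ) (b : Fin m → ℕ) : Prop :=
  ∃ σ : Equiv.Perm (Fin n), OrderedRefinement (a ∘ σ) b

/-- The complex of all subsets of `⋃ i, V i` meeting each part `V i` in at most `a i` vertices. -/
def boundedComplex {α : Type*} [DecidableEq α] {n : ℕ} (V : Fin n → Finset α)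
    (a : Fin n → ℕ) : Finset (Finset α) :=
  (univ.biUnion V).powerset.filter fun F => ∀ i, (F ∩ V i).card ≤ a i

/-- The sums of `a` over the fibres of `g`. -/
def fiberSum {n m : ℕ} (g : Fin n → Fin m) (a : Fin n → ℕ) (t : Fin m) : ℕ :=
  ∑ j ∈ univ.filter (fun j => g j = t), a j

section

variable {α : Type*} [DecidableEq α] {n m : ℕ}

theorem mem_boundedComplex {V : Fin n → Finset α} {a : Fin n → ℕ} {G : Finset α} :
    G ∈ boundedComplex V a ↔ G ⊆ univ.biUnion V ∧ ∀ i, (G ∩ V i).card ≤ a i := by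
  simp only [boundedComplex, mem_filter, mem_powerset]

theorem vertexSet_powerset (F : Finset α) : vertexSet F.powerset = F := by
  ext x
  simp only [vertexSet, mem_sup, mem_powerset, id]
  exact ⟨fun ⟨G, hG, hx⟩ => hG hx, fun hx => ⟨F, Subset.rfl, hx⟩⟩

theorem isSimplicialComplex_boundedComplex (V : Fin n → Finset α) (a : Fin n → ℕ) :
    IsSimplicialComplex (boundedComplex V a) := by
  refine ⟨⟨∅, by simp [mem_boundedComplex]⟩, fun F hF G hGF => ?_⟩
  rw [mem_boundedComplex] at hF ⊢
  exact ⟨hGF.trans hF.1,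
    fun i => (card_le_card (inter_subset_inter_right hGF)).trans (hF.2 i)⟩

/-- A face of `boundedComplex V a` extends to one meeting each `V i` in exactly `a i` vertices. -/
theorem exists_superset_of_mem_boundedComplex {V : Fin n → Finset α} {a : Fin n → ℕ}
    (hdisj : ∀ i j, i ≠ j → Disjoint (V i) (V j)) (hle : ∀ i, a i ≤ (V i).card)
    {G : Finset α} (hG : G ∈ boundedComplex V a) :
    ∃ H, G ⊆ H ∧ H ⊆ univ.biUnion V ∧ ∀ i, (H ∩ V i).card = a i := by
  rw [mem_boundedComplex] at hG
  choose K hGK hKV hK using fun i =>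
    exists_subsuperset_card_eq (inter_subset_right : G ∩ V i ⊆ V i) (hG.2 i) (hle i)
  refine ⟨univ.biUnion K, fun x hx => ?_, biUnion_mono fun i _ => hKV i, fun i => ?_⟩
  · obtain ⟨i, -, hi⟩ := mem_biUnion.1 (hG.1 hx)
    exact mem_biUnion.2 ⟨i, mem_univ i, hGK i (mem_inter.2 ⟨hx, hi⟩)⟩
  · rw [← hK i]
    congr 1
    ext x
    simp only [mem_inter, mem_biUnion, mem_univ, true_and]
    refine ⟨fun ⟨⟨j, hj⟩, hi⟩ => ?_, fun hx => ⟨⟨i, hx⟩, hKV i hx⟩⟩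
    by_cases hji : j = i
    · exact hji ▸ hj
    · exact absurd hi (disjoint_left.1 (hdisj j i hji) (hKV j hj))

theorem generatedComplex_eq_boundedComplex {V : Fin n → Finset α} {a : Fin n → ℕ}
    (hdisj : ∀ i j, i ≠ j → Disjoint (V i) (V j)) (hle : ∀ i, a i ≤ (V i).card) :
    generatedComplex ((univ.biUnion V).powerset.filter fun F => ∀ i, (F ∩ V i).card = a i) =
      boundedComplex V a := by
  ext G
  simp only [generatedComplex, mem_insert, mem_biUnion (s := filter _ _), mem_filter,
    mem_powerset]
  constructor
  · rintro (rfl | ⟨H, ⟨hHV, hH⟩, hGH⟩)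
    · simp [mem_boundedComplex]
    · exact (isSimplicialComplex_boundedComplex V a).2 H
        (mem_boundedComplex.2 ⟨hHV, fun i => (hH i).le⟩) G hGH
  · intro hG
    obtain ⟨H, hGH, hHV, hH⟩ := exists_superset_of_mem_boundedComplex hdisj hle hG
    exact Or.inr ⟨H, ⟨hHV, hH⟩, hGH⟩

theorem isRibOfSimplex_boundedComplex {V : Fin n → Finset α} {a : Fin n → ℕ} (hn : 0 < n)
    (hne : ∀ i, (V i).Nonempty) (hdisj : ∀ i j, i ≠ j → Disjoint (V i) (V j))
    (hle : ∀ i, a i ≤ (V i).card) : IsRibOfSimplex a (boundedComplex V a) := by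
  refine ⟨univ.biUnion V, ?_, V, ⟨hne, hdisj, (vertexSet_powerset _).symm⟩, ?_,
    (generatedComplex_eq_boundedComplex hdisj hle).symm⟩
  · obtain ⟨x, hx⟩ := hne ⟨0, hn⟩
    exact ⟨x, mem_biUnion.2 ⟨_, mem_univ _, hx⟩⟩
  · obtain ⟨H, -, hHV, hH⟩ := exists_superset_of_mem_boundedComplex hdisj hle
      (G := ∅) (by simp [mem_boundedComplex])
    exact ⟨H, mem_filter.2 ⟨mem_powerset.2 hHV, hH⟩⟩

theorem IsRibOfSimplex.exists_eq_boundedComplex {a : Fin n → ℕ} {Γ : Finset (Finset α)}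
    (h : IsRibOfSimplex a Γ) :
    ∃ V : Fin n → Finset α, (∀ i, (V i).Nonempty) ∧
      (∀ i j, i ≠ j → Disjoint (V i) (V j)) ∧ (∀ i, a i ≤ (V i).card) ∧
      Γ = boundedComplex V a := by
  obtain ⟨F, -, V, ⟨hne, hdisj, hV⟩, ⟨H, hH⟩, rfl⟩ := h
  have hle : ∀ i, a i ≤ (V i).card := fun i =>
    ((mem_filter.1 hH).2 i).symm.le.trans (card_le_card inter_subset_right)
  refine ⟨V, hne, hdisj, hle, ?_⟩
  rw [vertexSet_powerset] at hV
  rw [← hV, generatedComplex_eq_boundedComplex hdisj hle]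

theorem subset_biUnion_erase_iff {V : Fin n → Finset α} {x : α} {G : Finset α} :
    G ⊆ univ.biUnion (fun j => (V j).erase x) ↔ G ⊆ univ.biUnion V ∧ x ∉ G := by
  simp only [subset_iff, mem_biUnion, mem_univ, true_and, mem_erase]
  grind

theorem inter_erase_eq_of_notMem {x : α} {G W : Finset α} (hx : x ∉ G) :
    G ∩ W.erase x = G ∩ W := by
  ext y
  simp only [mem_inter, mem_erase]
  grind

theorem del_boundedComplex (V : Fin n → Finset α) (a : Fin n → ℕ) (x : α) :
    del (boundedComplex V a) x = boundedComplex (fun j => (V j).erase x) a := by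
  ext G
  simp only [del, mem_filter, mem_boundedComplex, subset_biUnion_erase_iff]
  constructor
  · rintro ⟨⟨hG, h⟩, hx⟩
    exact ⟨⟨hG, hx⟩, fun i => by rw [inter_erase_eq_of_notMem hx]; exact h i⟩
  · rintro ⟨⟨hG, hx⟩, h⟩
    exact ⟨⟨hG, fun i => by rw [← inter_erase_eq_of_notMem hx]; exact h i⟩, hx⟩

theorem lk_boundedComplex {V : Fin n → Finset α} {a : Fin n → ℕ} {x : α} {i : Fin n}
    (hdisj : ∀ i j, i ≠ j → Disjoint (V i) (V j)) (hx : x ∈ V i) (hi : 0 < a i) :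
    lk (boundedComplex V a) x =
      boundedComplex (fun j => (V j).erase x) (Function.update a i (a i - 1)) := by
  have hcard : ∀ G : Finset α, x ∉ G → (insert x G ∩ V i).card = (G ∩ V i).card + 1 := by
    intro G hG
    rw [insert_inter_of_mem hx, card_insert_of_notMem fun h => hG (mem_inter.1 h).1]
  have hcard' : ∀ (G : Finset α) (j : Fin n), j ≠ i → insert x G ∩ V j = G ∩ V j :=
    fun G j hj => insert_inter_of_notMem (disjoint_left.1 (hdisj i j hj.symm) hx)
  have hxV : x ∈ univ.biUnion V := mem_biUnion.2 ⟨i, mem_univ i, hx⟩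
  ext G
  simp only [lk, mem_filter, mem_boundedComplex, subset_biUnion_erase_iff]
  constructor
  · rintro ⟨⟨hG, h⟩, hxG, -, h'⟩
    refine ⟨⟨hG, hxG⟩, fun j => ?_⟩
    rw [inter_erase_eq_of_notMem hxG]
    by_cases hj : j = i
    · subst hj
      have := h' j
      rw [hcard G hxG] at this
      rw [Function.update_self]
      lia
    · rw [Function.update_of_ne hj]
      exact h j
  · rintro ⟨⟨hG, hxG⟩, h⟩
    have hGi : (G ∩ V i).card + 1 ≤ a i := by
      have := h i
      rw [inter_erase_eq_of_notMem hxG, Function.update_self] at this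
      lia
    have hGj : ∀ j, j ≠ i → (G ∩ V j).card ≤ a j := by
      intro j hj
      have := h j
      rwa [inter_erase_eq_of_notMem hxG, Function.update_of_ne hj] at this
    refine ⟨⟨hG, fun j => ?_⟩, hxG, insert_subset hxV hG, fun j => ?_⟩
    · by_cases hj : j = i
      · subst hj
        lia
      · exact hGj j hj
    · by_cases hj : j = i
      · subst hj
        rwa [hcard G hxG]
      · rw [hcard' G j hj]
        exact hGj j hj

theorem singleton_mem_boundedComplex {V : Fin n → Finset α} {a : Fin n → ℕ} {x : α} {i : Fin n}
    (hdisj : ∀ i j, i ≠ j → Disjoint (V i) (V j)) (hx : x ∈ V i) (hi : 0 < a i) :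
    {x} ∈ boundedComplex V a := by
  refine mem_boundedComplex.2
    ⟨singleton_subset_iff.2 (mem_biUnion.2 ⟨i, mem_univ i, hx⟩), fun j => ?_⟩
  by_cases hj : j = i
  · subst hj
    exact (card_le_card inter_subset_left).trans ((card_singleton x).trans_le hi)
  · rw [singleton_inter_of_notMem (disjoint_left.1 (hdisj i j (Ne.symm hj)) hx)]
    simp

/-- A face meeting `V i` in fewer than `a i ≤ |V i|` vertices is not a facet. -/
theorem not_isFacet_boundedComplex {V : Fin n → Finset α} {a : Fin n → ℕ} {i : Fin n}
    (hdisj : ∀ i j, i ≠ j → Disjoint (V i) (V j)) (hle : a i ≤ (V i).card)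
    {G : Finset α} (hG : (G ∩ V i).card < a i) : ¬ IsFacet (boundedComplex V a) G := by
  rintro ⟨hmem, hmax⟩
  rw [mem_boundedComplex] at hmem
  obtain ⟨y, hy, hyG⟩ := exists_mem_notMem_of_card_lt_card (hG.trans_le hle)
  have hyG : y ∉ G := fun h => hyG (mem_inter.2 ⟨h, hy⟩)
  refine hyG (hmax (insert y G) (mem_boundedComplex.2 ⟨insert_subset ?_ hmem.1, fun j => ?_⟩)
    (subset_insert y G) ▸ mem_insert_self y G)
  · exact mem_biUnion.2 ⟨i, mem_univ i, hy⟩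
  · by_cases hj : j = i
    · subst hj
      rw [insert_inter_of_mem hy]
      exact (card_insert_le _ _).trans hG
    · rw [insert_inter_of_notMem (disjoint_left.1 (hdisj i j (Ne.symm hj)) hy)]
      exact hmem.2 j

theorem fiberSum_lt_fiberSum (g : Fin n → Fin m) {a a' : Fin n → ℕ} (h : a' < a) :
    fiberSum g a' < fiberSum g a := by
  obtain ⟨hle, i, hi⟩ := Pi.lt_def.1 h
  refine Pi.lt_def.2 ⟨fun t => sum_le_sum fun j _ => hle j, g i, ?_⟩
  exact sum_lt_sum (fun j _ => hle j) ⟨i, by simp, hi⟩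

/-- If every `a i` is `0` or `|V i|`, then `boundedComplex V a` is a simplex, hence a rib of a
simplex for every vector of fibre sums of `a`. -/
theorem isRibOfSimplex_fiberSum {V : Fin n → Finset α} {a : Fin n → ℕ} {g : Fin n → Fin m}
    (hm : 0 < m) (hg : Function.Surjective g) (hne : ∀ i, (V i).Nonempty)
    (hdisj : ∀ i j, i ≠ j → Disjoint (V i) (V j)) (hfull : ∀ i, a i = 0 ∨ a i = (V i).card) :
    IsRibOfSimplex (fiberSum g a) (boundedComplex V a) := by
  set I : Fin m → Finset (Fin n) := fun t =>
    univ.filter fun i => g i = t ∧ (a i ≠ 0 ∨ fiberSum g a t = 0) with hI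
  set W : Fin m → Finset α := fun t => (I t).biUnion V with hW
  have hmemI : ∀ t i, i ∈ I t ↔ g i = t ∧ (a i ≠ 0 ∨ fiberSum g a t = 0) := by simp [hI]
  have hmemW : ∀ t x, x ∈ W t ↔ ∃ i ∈ I t, x ∈ V i := by simp [hW]
  have huniq : ∀ {i j x}, x ∈ V i → x ∈ V j → i = j := fun {i j x} hi hj =>
    by_contra fun hij => disjoint_left.1 (hdisj i j hij) hi hj
  have hsum : ∀ t, ∑ i ∈ I t, a i = fiberSum g a t := by
    intro t
    refine sum_subset (fun i hi => ?_) fun i hi hi' => ?_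
    · simpa using ((hmemI t i).1 hi).1
    · by_contra h0
      exact hi' ((hmemI t i).2 ⟨by simpa using hi, Or.inl h0⟩)
  have hcard : ∀ (G : Finset α) t, (G ∩ W t).card = ∑ i ∈ I t, (G ∩ V i).card := by
    intro G t
    rw [hW, inter_biUnion, card_biUnion]
    exact fun i _ j _ hij =>
      (hdisj i j hij).mono inter_subset_right inter_subset_right
  have hWne : ∀ t, (W t).Nonempty := by
    intro t
    obtain ⟨i, hi⟩ : (I t).Nonempty := by
      by_cases h0 : fiberSum g a t = 0
      · obtain ⟨i, hi⟩ := hg t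
        exact ⟨i, (hmemI t i).2 ⟨hi, Or.inr h0⟩⟩
      · rw [← hsum t] at h0
        obtain ⟨i, hi, -⟩ := exists_ne_zero_of_sum_ne_zero h0
        exact ⟨i, hi⟩
    obtain ⟨x, hx⟩ := hne i
    exact ⟨x, (hmemW t x).2 ⟨i, hi, hx⟩⟩
  have hWdisj : ∀ s t, s ≠ t → Disjoint (W s) (W t) := by
    intro s t hst
    refine disjoint_left.2 fun x hs ht => hst ?_
    obtain ⟨i, hi, hxi⟩ := (hmemW s x).1 hs
    obtain ⟨j, hj, hxj⟩ := (hmemW t x).1 ht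
    rw [← ((hmemI s i).1 hi).1, ← ((hmemI t j).1 hj).1, huniq hxi hxj]
  have hWle : ∀ t, fiberSum g a t ≤ (W t).card := by
    intro t
    rw [← inter_self (W t), hcard, ← hsum t]
    refine sum_le_sum fun i hi => ?_
    rw [inter_eq_right.2 (subset_biUnion_of_mem V hi)]
    rcases hfull i with h | h <;> simp [h]
  have heq : boundedComplex V a = boundedComplex W (fiberSum g a) := by
    ext G
    rw [mem_boundedComplex, mem_boundedComplex]
    constructor
    · rintro ⟨hG, h⟩
      refine ⟨fun x hx => ?_, fun t => ?_⟩
      · obtain ⟨i, -, hi⟩ := mem_biUnion.1 (hG hx)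
        have hpos : 0 < a i := (card_pos.2 ⟨x, mem_inter.2 ⟨hx, hi⟩⟩).trans_le (h i)
        exact mem_biUnion.2 ⟨g i, mem_univ _,
          (hmemW _ x).2 ⟨i, (hmemI _ i).2 ⟨rfl, Or.inl hpos.ne'⟩, hi⟩⟩
      · rw [hcard, ← hsum t]
        exact sum_le_sum fun i _ => h i
    · rintro ⟨hG, h⟩
      refine ⟨fun x hx => ?_, fun i => ?_⟩
      · obtain ⟨t, -, ht⟩ := mem_biUnion.1 (hG hx)
        obtain ⟨i, -, hi⟩ := (hmemW t x).1 ht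
        exact mem_biUnion.2 ⟨i, mem_univ i, hi⟩
      · rcases hfull i with h0 | h0
        · rw [h0, Nat.le_zero, card_eq_zero, ← not_nonempty_iff_eq_empty]
          rintro ⟨x, hx⟩
          obtain ⟨hxG, hxi⟩ := mem_inter.1 hx
          obtain ⟨t, -, ht⟩ := mem_biUnion.1 (hG hxG)
          obtain ⟨j, hj, hxj⟩ := (hmemW t x).1 ht
          obtain rfl := huniq hxi hxj
          have hb := (((hmemI t i).1 hj).2).resolve_left (not_not.2 h0)
          have hpos : 0 < (G ∩ W t).card := card_pos.2 ⟨x, mem_inter.2 ⟨hxG, ht⟩⟩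
          have := h t
          lia
        · rw [h0]
          exact card_le_card inter_subset_right
  rw [heq]
  exact isRibOfSimplex_boundedComplex hm hWne hWdisj hWle

theorem macaulayDecomposable_boundedComplex {g : Fin n → Fin m} (hm : 0 < m)
    (hg : Function.Surjective g) (V : Fin n → Finset α) (a : Fin n → ℕ)
    (hne : ∀ i, (V i).Nonempty) (hdisj : ∀ i j, i ≠ j → Disjoint (V i) (V j))
    (hle : ∀ i, a i ≤ (V i).card) :
    MacaulayDecomposable (fiberSum g a) (boundedComplex V a) := by
  induction hN : ∑ i, (V i).card using Nat.strong_induction_on generalizing V a with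
  | _ N ih =>
  by_cases hfull : ∀ i, a i = 0 ∨ a i = (V i).card
  · exact .rib _ _ (isRibOfSimplex_fiberSum hm hg hne hdisj hfull)
  · push Not at hfull
    obtain ⟨i, hi0, hiV⟩ := hfull
    have hpos : 0 < a i := Nat.pos_of_ne_zero hi0
    have hlt : a i < (V i).card := lt_of_le_of_ne (hle i) hiV
    obtain ⟨x, hx⟩ := hne i
    set V' : Fin n → Finset α := fun j => (V j).erase x with hV'
    have hVi : (V' i).card + 1 = (V i).card := card_erase_add_one hx
    have hVj : ∀ j, j ≠ i → V' j = V j := fun j hj =>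
      erase_eq_of_notMem (disjoint_left.1 (hdisj i j hj.symm) hx)
    have hle' : ∀ j, a j ≤ (V' j).card := by
      intro j
      by_cases hj : j = i
      · subst hj
        lia
      · rw [hVj j hj]
        exact hle j
    have hne' : ∀ j, (V' j).Nonempty := by
      intro j
      by_cases hj : j = i
      · subst hj
        exact card_pos.1 (hpos.trans_le (hle' j))
      · rw [hVj j hj]
        exact hne j
    have hdisj' : ∀ j k, j ≠ k → Disjoint (V' j) (V' k) := fun j k hjk =>
      (hdisj j k hjk).mono (erase_subset _ _) (erase_subset _ _)
    have hsum : ∑ j, (V' j).card < N := by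
      rw [← hN]
      exact sum_lt_sum (fun j _ => card_le_card (erase_subset _ _)) ⟨i, mem_univ i, by lia⟩
    have hupd : Function.update a i (a i - 1) < a :=
      update_lt_self_iff.2 (by lia)
    refine .shed _ (fiberSum g (Function.update a i (a i - 1))) _ x
      (isSimplicialComplex_boundedComplex V a) (singleton_mem_boundedComplex hdisj hx hpos)
      (fiberSum_lt_fiberSum g hupd) ?_ ?_ ?_
    · rw [del_boundedComplex]
      exact ih _ hsum V' a hne' hdisj' hle' rfl
    · rw [lk_boundedComplex hdisj hx hpos]
      exact ih _ hsum V' _ hne' hdisj' (fun j => (hupd.le j).trans (hle' j)) rfl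
    · intro F hF
      have hFi := (mem_boundedComplex.1 (lk_boundedComplex hdisj hx hpos ▸ hF.1)).2 i
      rw [Function.update_self] at hFi
      rw [del_boundedComplex]
      exact not_isFacet_boundedComplex hdisj' (hle' i) (by lia)

theorem MacaulayDecomposable.fiberSum {g : Fin n → Fin m} (hm : 0 < m)
    (hg : Function.Surjective g) {a : Fin n → ℕ} {Δ : Finset (Finset α)}
    (h : MacaulayDecomposable a Δ) : MacaulayDecomposable (fiberSum g a) Δ := by
  induction h with
  | rib a Γ h =>
    obtain ⟨V, hne, hdisj, hle, rfl⟩ := h.exists_eq_boundedComplex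
    exact macaulayDecomposable_boundedComplex hm hg V a hne hdisj hle
  | shed a a' Δ x hC hx hlt _ _ hfac ihdl ihlk =>
    exact .shed _ _ Δ x hC hx (fiberSum_lt_fiberSum g hlt) ihdl ihlk hfac

end

theorem PermutedRefinement.exists_eq_fiberSum {n m : ℕ} {a : Fin n → ℕ} {b : Fin m → ℕ}
    (h : PermutedRefinement a b) :
    ∃ g : Fin n → Fin m, Function.Surjective g ∧ b = fiberSum g a := by
  obtain ⟨σ, g, -, hg, hb⟩ := h
  refine ⟨g ∘ σ.symm, hg.comp σ.symm.surjective, funext fun t => (hb t).trans ?_⟩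
  exact sum_equiv σ (by simp) (by simp)

/-- If `a ≤_pr b`, then every `a`-Macaulay decomposable
complex is `b`-Macaulay decomposable. -/
theorem macaulayDecomposable_of_permutedRefinement {α : Type*} [DecidableEq α]
    {n m : ℕ} (hn : 0 < n) (hm : 0 < m) (a : Fin n → ℕ) (b : Fin m → ℕ)
    (Δ : Finset (Finset α)) (h : PermutedRefinement a b)
    (hmac : MacaulayDecomposable a Δ) :
    MacaulayDecomposable b Δ := by
  obtain ⟨g, hg, rfl⟩ := h.exists_eq_fiberSum
  exact hmac.fiberSum hm hg
end

section
/- Let a ∈ ℙ^n and let (Δ, π) be a pure balanced complex of type a. If (Δ, π) is color-shifted, then Δ is vertex-decomposable. -/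
open Finset

/-- `(Δ, V)` is a colored complex of type `a`. -/
def IsColoredComplex {α : Type*} [DecidableEq α] {n : ℕ} (a : Fin n → ℕ)
    (Δ : Finset (Finset α)) (V : Fin n → Finset α) : Prop :=
  IsSimplicialComplex Δ ∧ IsOrderedPartition V (vertexSet Δ) ∧
    ∀ F ∈ Δ, ∀ i, (F ∩ V i).card ≤ a i

/-- `(Δ, V)` is a balanced complex of type `a`: an `a`-colored complex of
dimension `|a| - 1`. -/
def IsBalancedComplex {α : Type*} [DecidableEq α] {n : ℕ} (a : Fin n → ℕ)
    (Δ : Finset (Finset α)) (V : Fin n → Finset α) : Prop :=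
  IsColoredComplex a Δ V ∧ (∀ F ∈ Δ, F.card ≤ ∑ i, a i) ∧ ∃ F ∈ Δ, F.card = ∑ i, a i

/-- `(Δ, V)` is color-shifted (with respect to the linear order on the vertices). -/
def IsColorShifted {α : Type*} [LinearOrder α] {n : ℕ} (Δ : Finset (Finset α))
    (V : Fin n → Finset α) : Prop :=
  ∀ F ∈ Δ, ∀ i : Fin n, ∀ v ∈ V i, ∀ v' ∈ V i,
    v' < v → v ∈ F → v' ∉ F → insert v' (F.erase v) ∈ Δ

/-- `Δ` is pure: all facets have the same dimension. -/
def IsPureComplex {α : Type*} (Δ : Finset (Finset α)) : Prop :=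
  ∀ F G, IsFacet Δ F → IsFacet Δ G → F.card = G.card

/-- `Δ` is a color-shifted complex with pairwise disjoint color classes `V i` (some of whose
elements need not be vertices of `Δ`), each of whose faces lies in a face having exactly `a i`
vertices of each color `i`. -/
structure IsPureColorShifted {α : Type*} [LinearOrder α] {n : ℕ} (a : Fin n → ℕ)
    (Δ : Finset (Finset α)) (V : Fin n → Finset α) : Prop where
  isSimplicialComplex : IsSimplicialComplex Δ
  disjoint : ∀ i j, i ≠ j → Disjoint (V i) (V j)
  exists_superset : ∀ F ∈ Δ, ∃ G ∈ Δ, F ⊆ G ∧ G ⊆ univ.biUnion V ∧ ∀ i, (G ∩ V i).card = a i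
  isColorShifted : IsColorShifted Δ V

namespace IsPureColorShifted

variable {α : Type*} [LinearOrder α] {n : ℕ} {a : Fin n → ℕ} {Δ : Finset (Finset α)}
  {V : Fin n → Finset α}

theorem eq_powerset (h : IsPureColorShifted a Δ V) (hV : ∀ i, (V i).card ≤ a i) :
    Δ = (univ.biUnion V).powerset := by
  obtain ⟨F₀, hF₀⟩ := h.isSimplicialComplex.1
  obtain ⟨G, hG, -, -, hGa⟩ := h.exists_superset F₀ hF₀
  have hle : univ.biUnion V ⊆ G := by
    refine biUnion_subset.2 fun i _ => ?_
    have := eq_of_subset_of_card_le (inter_subset_right : G ∩ V i ⊆ V i) (by rw [hGa]; exact hV i)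
    exact inter_eq_right.1 this
  ext F
  rw [mem_powerset]
  refine ⟨fun hF => ?_, fun hF => h.isSimplicialComplex.2 G hG F (hF.trans hle)⟩
  obtain ⟨H, -, hFH, hHV, -⟩ := h.exists_superset F hF
  exact hFH.trans hHV

/-- The largest vertex of a color class with more than `a i` elements can be exchanged for another
one in any face with exactly `a i` vertices of color `i`. -/
theorem exists_exchange (h : IsPureColorShifted a Δ V) {i : Fin n} {x : α} (hx : x ∈ V i)
    (hmax : ∀ v ∈ V i, v ≤ x) (hlt : a i < (V i).card) {G : Finset α} (hG : G ∈ Δ) (hxG : x ∈ G)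
    (hGi : (G ∩ V i).card = a i) : ∃ v ∈ V i, v ∉ G ∧ v ≠ x ∧ insert v (G.erase x) ∈ Δ := by
  obtain ⟨v, hv, hvG⟩ : ∃ v ∈ V i, v ∉ G ∩ V i := exists_mem_notMem_of_card_lt_card (hGi ▸ hlt)
  have hvG' : v ∉ G := fun hm => hvG (mem_inter.2 ⟨hm, hv⟩)
  have hne : v ≠ x := fun e => hvG' (e ▸ hxG)
  exact ⟨v, hv, hvG', hne,
    h.isColorShifted G hG i x hx v hv (lt_of_le_of_ne (hmax v hv) hne) hxG hvG'⟩

theorem biUnion_erase (V : Fin n → Finset α) (x : α) :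
    (univ.biUnion fun j => (V j).erase x) = (univ.biUnion V).erase x := by
  ext y
  simp

theorem disjoint_erase (h : IsPureColorShifted a Δ V) (x : α) (i j : Fin n) (hij : i ≠ j) :
    Disjoint ((V i).erase x) ((V j).erase x) :=
  (h.disjoint i j hij).mono (erase_subset _ _) (erase_subset _ _)

/-- An element of a color class that is not a vertex may be dropped. -/
theorem erase_of_not_vertex (h : IsPureColorShifted a Δ V) {x : α} (hx : {x} ∉ Δ) :
    IsPureColorShifted a Δ fun j => (V j).erase x where
  isSimplicialComplex := h.isSimplicialComplex
  disjoint := h.disjoint_erase x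
  exists_superset F hF := by
    obtain ⟨G, hG, hFG, hGV, hGa⟩ := h.exists_superset F hF
    have hxG : x ∉ G := fun hm => hx (h.isSimplicialComplex.2 G hG _ (singleton_subset_iff.2 hm))
    refine ⟨G, hG, hFG, ?_, fun j => ?_⟩
    · rw [biUnion_erase]
      exact subset_erase.2 ⟨hGV, hxG⟩
    · rw [inter_erase, erase_eq_of_notMem (by simp [hxG]), hGa]
  isColorShifted F hF i v hv w hw :=
    h.isColorShifted F hF i v (mem_of_mem_erase hv) w (mem_of_mem_erase hw)

theorem isPureColorShifted_lk (h : IsPureColorShifted a Δ V) {x : α} (hx : {x} ∈ Δ) :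
    IsPureColorShifted (fun j => if x ∈ V j then a j - 1 else a j) (lk Δ x)
      fun j => (V j).erase x where
  isSimplicialComplex := by
    have hdown := h.isSimplicialComplex.2
    refine ⟨⟨∅, mem_filter.2 ⟨hdown _ hx _ (empty_subset _), notMem_empty x, hx⟩⟩, ?_⟩
    intro F hF G hGF
    obtain ⟨hF, hxF, hFx⟩ := mem_filter.1 hF
    exact mem_filter.2 ⟨hdown F hF G hGF, fun hm => hxF (hGF hm),
      hdown _ hFx _ (insert_subset_insert x hGF)⟩
  disjoint := h.disjoint_erase x
  exists_superset F hF := by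
    obtain ⟨-, hxF, hFx⟩ := mem_filter.1 hF
    obtain ⟨G, hG, hFG, hGV, hGa⟩ := h.exists_superset _ hFx
    have hxG : x ∈ G := hFG (mem_insert_self x F)
    refine ⟨G.erase x, mem_filter.2 ⟨h.isSimplicialComplex.2 G hG _ (erase_subset _ _),
      notMem_erase x G, by rwa [insert_erase hxG]⟩,
      subset_erase.2 ⟨(subset_insert x F).trans hFG, hxF⟩, ?_, fun j => ?_⟩
    · rw [biUnion_erase]
      exact erase_subset_erase x hGV
    · rw [inter_erase, erase_inter, erase_idem, card_erase_eq_ite, hGa]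
      simp [hxG]
  isColorShifted F hF i v hv w hw hwv hvF hwF := by
    obtain ⟨-, hxF, hFx⟩ := mem_filter.1 hF
    obtain ⟨hvx, hv⟩ := mem_erase.1 hv
    obtain ⟨hwx, hw⟩ := mem_erase.1 hw
    have key := h.isColorShifted _ hFx i v hv w hw hwv (mem_insert_of_mem hvF)
      (by simp [hwx, hwF])
    rw [erase_insert_of_ne hvx.symm, insert_comm] at key
    exact mem_filter.2 ⟨h.isSimplicialComplex.2 _ key _ (subset_insert _ _),
      by simp [hwx.symm, hxF], key⟩

theorem isPureColorShifted_del (h : IsPureColorShifted a Δ V) {i : Fin n} {x : α} (hx : x ∈ V i)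
    (hmax : ∀ v ∈ V i, v ≤ x) (hlt : a i < (V i).card) :
    IsPureColorShifted a (del Δ x) fun j => (V j).erase x where
  isSimplicialComplex := by
    have hdown := h.isSimplicialComplex.2
    obtain ⟨F₀, hF₀⟩ := h.isSimplicialComplex.1
    refine ⟨⟨∅, mem_filter.2 ⟨hdown _ hF₀ _ (empty_subset _), notMem_empty x⟩⟩, ?_⟩
    intro F hF G hGF
    obtain ⟨hF, hxF⟩ := mem_filter.1 hF
    exact mem_filter.2 ⟨hdown F hF G hGF, fun hm => hxF (hGF hm)⟩
  disjoint := h.disjoint_erase x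
  exists_superset F hF := by
    obtain ⟨hF, hxF⟩ := mem_filter.1 hF
    suffices H : ∃ G ∈ Δ, F ⊆ G ∧ x ∉ G ∧ G ⊆ univ.biUnion V ∧ ∀ j, (G ∩ V j).card = a j by
      obtain ⟨G, hG, hFG, hxG, hGV, hGa⟩ := H
      refine ⟨G, mem_filter.2 ⟨hG, hxG⟩, hFG, ?_, fun j => ?_⟩
      · rw [biUnion_erase]
        exact subset_erase.2 ⟨hGV, hxG⟩
      · rw [inter_erase, erase_eq_of_notMem (by simp [hxG]), hGa]
    obtain ⟨G, hG, hFG, hGV, hGa⟩ := h.exists_superset F hF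
    by_cases hxG : x ∈ G
    swap
    · exact ⟨G, hG, hFG, hxG, hGV, hGa⟩
    obtain ⟨v, hv, hvG, hvx, hvΔ⟩ := h.exists_exchange hx hmax hlt hG hxG (hGa i)
    refine ⟨_, hvΔ, (subset_erase.2 ⟨hFG, hxF⟩).trans (subset_insert _ _), by simp [hvx.symm],
      insert_subset (mem_biUnion.2 ⟨i, mem_univ i, hv⟩) ((erase_subset _ _).trans hGV),
      fun j => ?_⟩
    by_cases hij : i = j
    · subst hij
      rw [insert_inter_of_mem hv, erase_inter, card_insert_of_notMem (by simp [hvG]),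
        card_erase_add_one (mem_inter.2 ⟨hxG, hx⟩), hGa]
    · have hd := disjoint_left.1 (h.disjoint i j hij)
      rw [insert_inter_of_notMem (hd hv), erase_inter,
        erase_eq_of_notMem (fun hm => hd hx (mem_inter.1 hm).2), hGa]
  isColorShifted F hF i v hv w hw hwv hvF hwF := by
    obtain ⟨hF, hxF⟩ := mem_filter.1 hF
    obtain ⟨hvx, hv⟩ := mem_erase.1 hv
    obtain ⟨hwx, hw⟩ := mem_erase.1 hw
    exact mem_filter.2 ⟨h.isColorShifted _ hF i v hv w hw hwv hvF hwF, by simp [hwx.symm, hxF]⟩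

theorem not_isFacet_del (h : IsPureColorShifted a Δ V) {i : Fin n} {x : α} (hx : x ∈ V i)
    (hmax : ∀ v ∈ V i, v ≤ x) (hlt : a i < (V i).card) {F : Finset α} (hF : F ∈ lk Δ x) :
    ¬ IsFacet (del Δ x) F := by
  rintro ⟨-, hFmax⟩
  obtain ⟨-, hxF, hFx⟩ := mem_filter.1 hF
  obtain ⟨G, hG, hFG, -, hGa⟩ := h.exists_superset _ hFx
  obtain ⟨v, -, hvG, hvx, hvΔ⟩ :=
    h.exists_exchange hx hmax hlt hG (hFG (mem_insert_self x F)) (hGa i)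
  have hFG' : F ⊆ G := (subset_insert x F).trans hFG
  have key := hFmax (insert v (G.erase x)) (mem_filter.2 ⟨hvΔ, by simp [hvx.symm]⟩)
    ((subset_erase.2 ⟨hFG', hxF⟩).trans (subset_insert _ _))
  exact hvG (hFG' (key ▸ mem_insert_self v _))

theorem vertexDecomposable (h : IsPureColorShifted a Δ V) : VertexDecomposable Δ := by
  induction hm : (univ.biUnion V).card using Nat.strong_induction_on generalizing a Δ V with
  | _ m ih =>
  by_cases hV : ∀ i, (V i).card ≤ a i
  · rw [h.eq_powerset hV]
    rcases (univ.biUnion V).eq_empty_or_nonempty with he | hne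
    · rw [he, powerset_empty]
      exact .ofEmpty
    · exact .simplex _ hne
  · push Not at hV
    obtain ⟨i, hlt⟩ := hV
    have hne : (V i).Nonempty := card_pos.1 (Nat.zero_lt_of_lt hlt)
    obtain ⟨x, hx, hmax⟩ : ∃ x ∈ V i, ∀ v ∈ V i, v ≤ x :=
      ⟨(V i).max' hne, max'_mem _ _, fun v hv => le_max' _ v hv⟩
    have hcard : (univ.biUnion fun j => (V j).erase x).card < m := by
      rw [biUnion_erase, ← hm]
      exact card_erase_lt_of_mem (mem_biUnion.2 ⟨i, mem_univ i, hx⟩)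
    by_cases hxΔ : {x} ∈ Δ
    · exact .shed Δ x h.isSimplicialComplex hxΔ
        (ih _ hcard (h.isPureColorShifted_del hx hmax hlt) rfl)
        (ih _ hcard (h.isPureColorShifted_lk hxΔ) rfl)
        fun F hF => h.not_isFacet_del hx hmax hlt hF.1
    · exact ih _ hcard (h.erase_of_not_vertex hxΔ) rfl

end IsPureColorShifted

theorem exists_isFacet_superset {α : Type*} {Δ : Finset (Finset α)} {F : Finset α} (hF : F ∈ Δ) :
    ∃ G, F ⊆ G ∧ IsFacet Δ G := by
  obtain ⟨G, hFG, hG⟩ := Δ.exists_le_maximal hF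
  exact ⟨G, hFG, hG.1, fun H hH hGH => (hG.eq_of_le hH hGH).symm⟩

theorem IsBalancedComplex.isPureColorShifted {α : Type*} [LinearOrder α] {n : ℕ} {a : Fin n → ℕ}
    {Δ : Finset (Finset α)} {V : Fin n → Finset α} (hbal : IsBalancedComplex a Δ V)
    (hpure : IsPureComplex Δ) (hcs : IsColorShifted Δ V) : IsPureColorShifted a Δ V := by
  obtain ⟨⟨hC, ⟨-, hdisj, hunion⟩, hle⟩, hdim, F₀, hF₀, hF₀card⟩ := hbal
  refine ⟨hC, hdisj, fun F hF => ?_, hcs⟩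
  obtain ⟨G, hFG, hG⟩ := exists_isFacet_superset hF
  obtain ⟨H, hFH, hH⟩ := exists_isFacet_superset hF₀
  have hGcard : G.card = ∑ i, a i := by
    rw [hpure G H hG hH]
    exact le_antisymm (hdim H hH.1) (hF₀card ▸ card_le_card hFH)
  have hGV : G ⊆ univ.biUnion V := by
    rw [hunion]
    exact le_sup (f := id) hG.1
  refine ⟨G, hG.1, hFG, hGV, fun i => ?_⟩
  have hsum : ∑ i, (G ∩ V i).card = ∑ i, a i := by
    rw [← hGcard, ← card_biUnion fun i _ j _ hij =>
      (hdisj i j hij).mono inter_subset_right inter_subset_right, ← inter_biUnion,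
      inter_eq_left.2 hGV]
  exact (sum_eq_sum_iff_of_le fun i _ => hle G hG.1 i).1 hsum i (mem_univ i)

/-- A pure color-shifted balanced complex of type `a` is
vertex-decomposable. -/
theorem colorShifted_vertexDecomposable {α : Type*} [LinearOrder α] {n : ℕ}
    (hn : 0 < n) (a : Fin n → ℕ) (ha : ∀ i, 0 < a i)
    (Δ : Finset (Finset α)) (V : Fin n → Finset α)
    (hbal : IsBalancedComplex a Δ V) (hpure : IsPureComplex Δ)
    (hcs : IsColorShifted Δ V) :
    VertexDecomposable Δ := by
  exact (hbal.isPureColorShifted hpure hcs).vertexDecomposable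
end
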